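/- Let f ∈ Z^∞(D) be an outer function. Then there exists a sequence {A_m}_{m≥1} of open subsets of T such that: (1) Z_T(f) ⊆ A_m for all m ≥ 1; (2) for each m ≥ 1 there is an open set U_m ⊆ T with closure(A_{m+1}) ⊆ U_m ⊆ A_m; (3) μ(A_m) decreases to 0 as m → ∞; and (4) |f̃| ≤ e^{−m} a.e. on A_m for all m ≥ 1. -/

import Mathlib

set_option synthInstance.maxHeartbeats 1000000
set_option maxHeartbeats 1000000

open Complex MeasureTheory Metric Set Filter

noncomputable section

open scoped Classical in
/-- Extension by zero of a function on the open unit disc to the whole plane. -/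
def cext (f : (Metric.ball (0:ℂ) 1 : Set ℂ) → ℂ) : ℂ → ℂ :=
  fun z => if h : z ∈ Metric.ball (0:ℂ) 1 then f ⟨z, h⟩ else 0

theorem cext_of_mem (f : (Metric.ball (0:ℂ) 1 : Set ℂ) → ℂ) {z : ℂ}
    (h : z ∈ Metric.ball (0:ℂ) 1) : cext f z = f ⟨z, h⟩ := dif_pos h

/-- `H^∞(𝔻)`: the algebra of bounded analytic functions on the open unit disc, realized as a
subalgebra of the bounded continuous functions on the disc (with the supremum norm). -/
def Hinf : Subalgebra ℂ (BoundedContinuousFunction (Metric.ball (0:ℂ) 1 : Set ℂ) ℂ) where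
  carrier := {f | DifferentiableOn ℂ (cext ⇑f) (Metric.ball (0:ℂ) 1)}
  mul_mem' := by
    intro f g hf hg
    exact (hf.mul hg).congr (fun z hz => by simp [cext_of_mem _ hz])
  add_mem' := by
    intro f g hf hg
    exact (hf.add hg).congr (fun z hz => by simp [cext_of_mem _ hz])
  algebraMap_mem' := by
    intro c
    exact (differentiableOn_const c).congr (fun z hz => by simp [cext_of_mem _ hz])

/-- The canonical extension-by-zero of an element of `H^∞(𝔻)` to the plane. -/
def hfun (f : Hinf) : ℂ → ℂ :=
  cext ⇑(f : BoundedContinuousFunction (Metric.ball (0:ℂ) 1 : Set ℂ) ℂ)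

/-- Normalized Lebesgue (arc-length) measure on the unit circle, as a measure on `ℂ`. -/
def circleMeasure : Measure ℂ :=
  (ENNReal.ofReal (2 * Real.pi)⁻¹) •
    Measure.map (fun θ : ℝ => Complex.exp (θ * Complex.I))
      (volume.restrict (Set.Ioc (-Real.pi) Real.pi))

/-- The radial limit `f̃(z) = lim_{r→1⁻} f(rz)` (junk value if the limit does not exist). -/
def radLimF (f : ℂ → ℂ) (z : ℂ) : ℂ :=
  limUnder (nhdsWithin (1 : ℝ) (Set.Iio 1)) fun r : ℝ => f ((r : ℂ) * z)

/-- The essential zeros on the circle of a function on the plane: points `z ∈ 𝕋` such that for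
every `ε > 0` and every open neighborhood `N` of `z`, the set `|f̃|⁻¹((0, ε)) ∩ N` has nonzero
measure.  (Since `|f̃| = |f̃_O|` a.e. on `𝕋`, for `f ∈ H^∞(𝔻)` this coincides with the essential
zero set of the outer factor `f_O` of `f`.) -/
def ZTF (f : ℂ → ℂ) : Set ℂ :=
  {z | z ∈ Metric.sphere (0:ℂ) 1 ∧ ∀ ε > (0:ℝ), ∀ N : Set ℂ, IsOpen N → z ∈ N →
    circleMeasure ({w : ℂ | ‖radLimF f w‖ ∈ Set.Ioo 0 ε} ∩ N) ≠ 0}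

/-- The essential zero set `Z_𝕋(f)` of `f ∈ H^∞(𝔻)`. -/
def ZT (f : Hinf) : Set ℂ := ZTF (hfun f)

/-- `Z^∞(𝔻)`: those `f ∈ H^∞(𝔻)` that extend continuously to `𝔻 ∪ Z_𝕋(f)`. -/
def Zinf : Set Hinf :=
  {f | ∃ F : ℂ → ℂ, ContinuousOn F (Metric.ball (0:ℂ) 1 ∪ ZT f) ∧
    ∀ z ∈ Metric.ball (0:ℂ) 1, F z = hfun f z}

open scoped Classical in
/-- Truncation of a function to the open unit disc (zero outside). -/
def trunc (f : ℂ → ℂ) : ℂ → ℂ := fun z => if z ∈ Metric.ball (0:ℂ) 1 then f z else 0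

/-- The mean of `‖f‖²` over the circle of radius `r`. -/
def H2Int (f : ℂ → ℂ) (r : ℝ) : ℝ :=
  (2 * Real.pi)⁻¹ *
    ∫ θ in Set.Ioc 0 (2 * Real.pi), ‖f ((r : ℂ) * Complex.exp (θ * Complex.I))‖ ^ 2

/-- Membership in the Hardy space `H²(𝔻)` (functions normalized to vanish off the disc):
analytic on `𝔻` with bounded quadratic means. -/
def MemH2 (f : ℂ → ℂ) : Prop :=
  DifferentiableOn ℂ f (Metric.ball (0:ℂ) 1) ∧ (∀ z ∉ Metric.ball (0:ℂ) 1, f z = 0) ∧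
    BddAbove (Set.range fun r : Set.Ioo (0:ℝ) 1 => H2Int f r)

/-- The `H²(𝔻)` norm. -/
def H2norm (f : ℂ → ℂ) : ℝ :=
  Real.sqrt (⨆ r : Set.Ioo (0:ℝ) 1, H2Int f r)

/-- `f` is an outer function: `f ∈ H²(𝔻)` and `span {zᵐ f : m ≥ 0}`, i.e. the set of polynomial
multiples of `f`, is dense in `H²(𝔻)`. -/
def IsOuterF (f : ℂ → ℂ) : Prop :=
  MemH2 (trunc f) ∧ ∀ g, MemH2 g → ∀ ε > (0:ℝ), ∃ p : Polynomial ℂ,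
    H2norm (fun z => g z - p.eval z * trunc f z) < ε

/-- An element of `H^∞(𝔻)` is outer if its extension-by-zero is outer. -/
def IsOuterHinf (f : Hinf) : Prop := IsOuterF (hfun f)

/-- A relatively open subset of the unit circle. -/
def IsOpenInCircle (A : Set ℂ) : Prop :=
  ∃ V : Set ℂ, IsOpen V ∧ A = V ∩ Metric.sphere (0:ℂ) 1

theorem norm_exp_mul_I_sub_ofReal_sq (t r : ℝ) :
    ‖Complex.exp (t * I) - r‖ ^ 2 = (1 - r) ^ 2 + 2 * r * (1 - Real.cos t) := by
  rw [← Complex.normSq_eq_norm_sq, Complex.normSq_apply]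
  simp only [Complex.sub_re, Complex.sub_im, Complex.exp_ofReal_mul_I_re,
    Complex.exp_ofReal_mul_I_im, Complex.ofReal_re, Complex.ofReal_im]
  nlinarith [Real.sin_sq_add_cos_sq t]

theorem le_five_mul_norm_exp_mul_I_sub_sq {t r : ℝ} (ht : |t| ≤ Real.pi) (hr : 1 / 2 ≤ r) :
    (1 - r) ^ 2 + t ^ 2 ≤ 5 * ‖Complex.exp (t * I) - r‖ ^ 2 := by
  rw [norm_exp_mul_I_sub_ofReal_sq]
  have h := Real.cos_le_one_sub_mul_cos_sq ht
  have hpi : Real.pi ^ 2 < 10 := by nlinarith [Real.pi_lt_d2, Real.pi_pos]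
  have h2 : t ^ 2 / 5 ≤ 2 / Real.pi ^ 2 * t ^ 2 := by
    have : (1 : ℝ) / 5 ≤ 2 / Real.pi ^ 2 := by
      rw [div_le_div_iff₀ (by norm_num) (by positivity)]; linarith
    nlinarith [sq_nonneg t]
  have h3 : 1 - Real.cos t ≤ 2 * r * (1 - Real.cos t) := by
    nlinarith [Real.cos_le_one t]
  nlinarith [sq_nonneg (1 - r)]

theorem circleIntegral_inv_sub_sq_mul {E : ℂ → ℂ} (hE : DiffContOnCl ℂ E (ball 0 1)) {z : ℂ}
    (hz : z ∈ ball (0 : ℂ) 1) :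
    (∮ ζ in C(0, 1), ((ζ - z) ^ 2)⁻¹ * E ζ) = 2 * Real.pi * I * deriv E z := by
  have hcont : ContinuousOn E (closedBall 0 1) := by
    simpa [closure_ball] using hE.continuousOn
  have hnhds : closedBall (0 : ℂ) 1 ∈ nhds z :=
    mem_of_superset (isOpen_ball.mem_nhds hz) ball_subset_closedBall
  have hdz : DifferentiableAt ℂ E z := hE.differentiableAt isOpen_ball hz
  have hq : DiffContOnCl ℂ (dslope E z) (ball 0 1) := by
    refine ⟨(Complex.differentiableOn_dslope (isOpen_ball.mem_nhds hz)).2 hE.differentiableOn, ?_⟩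
    rw [closure_ball _ one_ne_zero]
    exact (continuousOn_dslope hnhds).2 ⟨hcont, hdz⟩
  have h := hq.circleIntegral_sub_inv_smul hz
  have hne : ∀ ζ ∈ sphere (0 : ℂ) 1, ζ - z ≠ 0 := by
    intro ζ hζ h0
    rw [sub_eq_zero] at h0
    subst h0
    simp at hζ hz
    linarith
  have h0 : (∮ ζ in C(0, 1), (ζ - z) ^ (-2 : ℤ)) = 0 :=
    circleIntegral.integral_sub_zpow_of_ne (by norm_num) _ _ _
  have hci : CircleIntegrable (fun ζ => ((ζ - z) ^ 2)⁻¹ * E ζ) 0 1 := by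
    apply ContinuousOn.circleIntegrable zero_le_one
    refine ContinuousOn.mul (ContinuousOn.inv₀ (by fun_prop) fun ζ hζ => pow_ne_zero _ (hne ζ hζ))
      (hcont.mono sphere_subset_closedBall)
  have hci' : CircleIntegrable (fun ζ => E z * (ζ - z) ^ (-2 : ℤ)) 0 1 := by
    apply ContinuousOn.circleIntegrable zero_le_one
    exact ContinuousOn.mul continuousOn_const
      (ContinuousOn.zpow₀ (by fun_prop) _ fun ζ hζ => Or.inl (hne ζ hζ))
  have h1 : (∮ ζ in C(0, 1), (ζ - z)⁻¹ • dslope E z ζ) =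
      ∮ ζ in C(0, 1), (((ζ - z) ^ 2)⁻¹ * E ζ - E z * (ζ - z) ^ (-2 : ℤ)) := by
    apply circleIntegral.integral_congr zero_le_one
    intro ζ hζ
    have := hne ζ hζ
    have hzζ : ζ ≠ z := sub_ne_zero.1 this
    simp only [dslope_of_ne _ hzζ, slope_def_field, smul_eq_mul, zpow_neg]
    field_simp
  rw [circleIntegral.integral_sub hci hci', circleIntegral.integral_const_mul, h0, mul_zero,
    sub_zero] at h1
  rw [← h1, h, dslope_same, smul_eq_mul]

theorem circleIntegral_inv_sub_sq_mul_eq_zero {E : ℂ → ℂ} (hE : DiffContOnCl ℂ E (ball 0 1))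
    {w : ℂ} (hw : 1 < ‖w‖) :
    (∮ ζ in C(0, 1), ((ζ - w) ^ 2)⁻¹ * E ζ) = 0 := by
  apply DiffContOnCl.circleIntegral_eq_zero zero_le_one
  refine DiffContOnCl.smul (f := E) (c := fun ζ : ℂ => ((ζ - w) ^ 2)⁻¹) ?_ hE
  apply DifferentiableOn.diffContOnCl
  rw [closure_ball _ one_ne_zero]
  refine DifferentiableOn.inv (by fun_prop) fun ζ hζ => pow_ne_zero _ fun h => ?_
  rw [sub_eq_zero] at h
  subst h
  simp at hζ
  linarith

theorem norm_inv_sq_sub_inv_sq_le {ζ : ℂ} (hζ : ‖ζ‖ = 1) {r : ℝ} (hr : r < 1) (hr0 : 0 < r) :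
    ‖((ζ - r) ^ 2)⁻¹ - ((ζ - (2 - r : ℝ)) ^ 2)⁻¹‖ ≤ 4 * (1 - r) / ‖ζ - r‖ ^ 3 := by
  have hre : ζ.re ≤ 1 := hζ ▸ Complex.re_le_norm ζ
  set a := ζ - r with ha
  set b := ζ - (2 - r : ℝ) with hb
  have ha0 : 0 < ‖a‖ := by
    have := norm_sub_norm_le ζ r
    rw [hζ, Complex.norm_real, Real.norm_of_nonneg hr0.le] at this
    linarith
  have hab : ‖a‖ ≤ ‖b‖ := by
    rw [← sq_le_sq₀ (norm_nonneg _) (norm_nonneg _), ← Complex.normSq_eq_norm_sq,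
      ← Complex.normSq_eq_norm_sq, Complex.normSq_apply, Complex.normSq_apply]
    simp only [ha, hb, Complex.sub_re, Complex.sub_im, Complex.ofReal_re, Complex.ofReal_im]
    nlinarith
  have hb0 : 0 < ‖b‖ := ha0.trans_le hab
  have ha' : a ≠ 0 := norm_pos_iff.1 ha0
  have hb' : b ≠ 0 := norm_pos_iff.1 hb0
  have hba : b - a = ((-(2 * (1 - r)) : ℝ) : ℂ) := by
    simp only [ha, hb]; push_cast; ring
  have hkey : (a ^ 2)⁻¹ - (b ^ 2)⁻¹ = (b - a) * (b + a) / (a ^ 2 * b ^ 2) := by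
    field_simp; ring
  rw [hkey, hba, norm_div, norm_mul, norm_mul, norm_pow, norm_pow, Complex.norm_real, norm_neg,
    Real.norm_of_nonneg (by linarith), div_le_div_iff₀ (by positivity) (by positivity)]
  have h1 : ‖b + a‖ ≤ 2 * ‖b‖ := (norm_add_le _ _).trans (by linarith)
  have h2 : ‖b‖ * ‖a‖ ≤ ‖b‖ ^ 2 := by nlinarith
  calc 2 * (1 - r) * ‖b + a‖ * ‖a‖ ^ 3 ≤ 2 * (1 - r) * (2 * ‖b‖) * ‖a‖ ^ 3 := by
        gcongr
    _ = 4 * (1 - r) * (‖a‖ ^ 2 * (‖b‖ * ‖a‖)) := by ring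
    _ ≤ 4 * (1 - r) * (‖a‖ ^ 2 * ‖b‖ ^ 2) := by
        gcongr

theorem deriv_eq_integral_of_diffContOnCl {E : ℂ → ℂ} (hE : DiffContOnCl ℂ E (ball 0 1)) {r : ℝ}
    (hr : r < 1) (hr0 : 0 < r) :
    2 * Real.pi * I * deriv E r = ∫ t in (-Real.pi)..Real.pi, (Complex.exp (t * I) * I) *
      ((((Complex.exp (t * I) - r) ^ 2)⁻¹ - ((Complex.exp (t * I) - (2 - r : ℝ)) ^ 2)⁻¹) *
        E (Complex.exp (t * I))) := by
  have hcont : ContinuousOn E (sphere 0 1) := by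
    refine hE.continuousOn.mono ?_
    rw [closure_ball _ one_ne_zero]
    exact sphere_subset_closedBall
  have hz : (r : ℂ) ∈ ball (0 : ℂ) 1 := by
    simpa [abs_of_pos hr0] using hr
  have hw : 1 < ‖((2 - r : ℝ) : ℂ)‖ := by
    rw [Complex.norm_real, Real.norm_of_nonneg (by linarith)]
    linarith
  have hci : ∀ v : ℂ, ‖v‖ ≠ 1 → CircleIntegrable (fun ζ => ((ζ - v) ^ 2)⁻¹ * E ζ) 0 1 := by
    intro v hv
    apply ContinuousOn.circleIntegrable zero_le_one
    refine ContinuousOn.mul (ContinuousOn.inv₀ (by fun_prop) fun ζ hζ => pow_ne_zero _ ?_) hcont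
    intro h
    rw [sub_eq_zero] at h
    subst h
    simp at hζ
    exact hv hζ
  have h := circleIntegral_inv_sub_sq_mul hE hz
  have h' := circleIntegral.integral_sub (hci r (by simp [abs_of_pos hr0, hr.ne])) (hci _ hw.ne')
  rw [h, circleIntegral_inv_sub_sq_mul_eq_zero hE hw, sub_zero] at h'
  rw [← h', circleIntegral]
  have hper : Function.Periodic (fun t : ℝ => (Complex.exp (t * I) * I) *
      ((((Complex.exp (t * I) - r) ^ 2)⁻¹ - ((Complex.exp (t * I) - (2 - r : ℝ)) ^ 2)⁻¹) *
        E (Complex.exp (t * I)))) (2 * Real.pi) := by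
    intro t
    have : Complex.exp (((t + 2 * Real.pi : ℝ) : ℂ) * I) = Complex.exp (t * I) := by
      push_cast
      rw [add_mul, Complex.exp_periodic]
    simp only [this]
  have h2 := hper.intervalIntegral_add_eq (-Real.pi) 0
  rw [show -Real.pi + 2 * Real.pi = Real.pi by ring, zero_add] at h2
  rw [h2]
  congr 1
  ext t
  simp only [deriv_circleMap, circleMap, Complex.ofReal_one, one_mul, zero_add, smul_eq_mul,
    sub_mul]

theorem integral_div_sq_add_sq_le {δ : ℝ} (hδ : 0 < δ) (a b : ℝ) :
    ∫ t in a..b, δ / (δ ^ 2 + t ^ 2) ≤ Real.pi := by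
  have h : ∀ t : ℝ, δ / (δ ^ 2 + t ^ 2) = δ⁻¹ * (1 + (t / δ) ^ 2)⁻¹ := by
    intro t
    field_simp
  simp_rw [h]
  rw [intervalIntegral.integral_const_mul,
    intervalIntegral.integral_comp_div (fun x : ℝ => (1 + x ^ 2)⁻¹) hδ.ne',
    integral_inv_one_add_sq, smul_eq_mul, inv_mul_cancel_left₀ hδ.ne']
  linarith [Real.arctan_lt_pi_div_two (b / δ), Real.neg_pi_div_two_lt_arctan (a / δ)]

theorem norm_deriv_le_of_norm_exp_le {E : ℂ → ℂ} (hE : DiffContOnCl ℂ E (ball 0 1)) {ε M : ℝ}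
    (hε : 0 ≤ ε) (hM : 0 ≤ M)
    (hb : ∀ t : ℝ, |t| ≤ Real.pi → ‖E (Complex.exp (t * I))‖ ≤ ε * |t| + M * |t| ^ 3) {r : ℝ}
    (hr : r < 1) (hr2 : 1 / 2 ≤ r) :
    ‖deriv E r‖ ≤ 30 * ε + 108 * M * (1 - r) := by
  have hδ : 0 < 1 - r := by linarith
  have h := deriv_eq_integral_of_diffContOnCl hE hr (by linarith)
  have hpi := Real.pi_pos
  have hint : IntervalIntegrable
      (fun t : ℝ => 60 * ε * ((1 - r) / ((1 - r) ^ 2 + t ^ 2)) + 108 * M * (1 - r)) volume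
      (-Real.pi) Real.pi := by
    apply Continuous.intervalIntegrable
    refine (continuous_const.mul (Continuous.div continuous_const (by fun_prop) ?_)).add
      continuous_const
    intro t
    positivity
  have hint' : IntervalIntegrable (fun t : ℝ => ((1 - r) / ((1 - r) ^ 2 + t ^ 2))) volume
      (-Real.pi) Real.pi := by
    apply Continuous.intervalIntegrable
    refine Continuous.div continuous_const (by fun_prop) ?_
    intro t
    positivity
  have hle := intervalIntegral.norm_integral_le_of_norm_le (by linarith : -Real.pi ≤ Real.pi)
    (f := fun t : ℝ => (Complex.exp (t * I) * I) *
      ((((Complex.exp (t * I) - r) ^ 2)⁻¹ - ((Complex.exp (t * I) - (2 - r : ℝ)) ^ 2)⁻¹) *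
        E (Complex.exp (t * I)))) (Filter.Eventually.of_forall fun t ht => ?_) hint
  · rw [← h, intervalIntegral.integral_add (hint'.const_mul _) (by simp),
      intervalIntegral.integral_const_mul, intervalIntegral.integral_const, smul_eq_mul,
      norm_mul, norm_mul, norm_mul, Complex.norm_I, Complex.norm_real, Complex.norm_ofNat,
      Real.norm_of_nonneg hpi.le] at hle
    have h3 := integral_div_sq_add_sq_le hδ (-Real.pi) Real.pi
    have h4 : 60 * ε * ∫ t in (-Real.pi)..Real.pi, (1 - r) / ((1 - r) ^ 2 + t ^ 2) ≤
        60 * ε * Real.pi := by gcongr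
    have h5 : Real.pi * ‖deriv E r‖ ≤ Real.pi * (30 * ε + 108 * M * (1 - r)) := by linarith
    exact le_of_mul_le_mul_left h5 hpi
  · have htpi : |t| ≤ Real.pi := abs_le.2 ⟨ht.1.le, ht.2⟩
    have h1 := le_five_mul_norm_exp_mul_I_sub_sq htpi hr2
    have h2 := norm_inv_sq_sub_inv_sq_le (Complex.norm_exp_ofReal_mul_I t) hr (by linarith)
    set n := ‖Complex.exp (t * I) - r‖ with hn
    have hn0 : 0 < n := by
      refine lt_of_le_of_ne (norm_nonneg _) fun h0 => ?_
      rw [← h0] at h1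
      nlinarith [sq_nonneg t]
    have htn : |t| ≤ 3 * n := by
      rw [← sq_le_sq₀ (abs_nonneg _) (by positivity), sq_abs]
      nlinarith
    rw [norm_mul, norm_mul, norm_mul, Complex.norm_exp_ofReal_mul_I, Complex.norm_I, mul_one,
      one_mul]
    have hA : |t| / n ^ 3 ≤ 15 / ((1 - r) ^ 2 + t ^ 2) := by
      rw [div_le_div_iff₀ (by positivity) (by positivity)]
      calc |t| * ((1 - r) ^ 2 + t ^ 2) ≤ 3 * n * (5 * n ^ 2) := by gcongr
        _ = 15 * n ^ 3 := by ring
    have hB : |t| ^ 3 / n ^ 3 ≤ 27 := by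
      rw [div_le_iff₀ (by positivity)]
      calc |t| ^ 3 ≤ (3 * n) ^ 3 := by gcongr
        _ = 27 * n ^ 3 := by ring
    calc _ ≤ 4 * (1 - r) / n ^ 3 * (ε * |t| + M * |t| ^ 3) := by
          gcongr
          exact hb t htpi
      _ = 4 * (1 - r) * (ε * (|t| / n ^ 3) + M * (|t| ^ 3 / n ^ 3)) := by ring
      _ ≤ 4 * (1 - r) * (ε * (15 / ((1 - r) ^ 2 + t ^ 2)) + M * 27) := by gcongr
      _ = _ := by ring

theorem tendsto_deriv_of_hasDerivAt_zero {E : ℂ → ℂ} {K : NNReal} (hK : LipschitzWith K E)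
    (hE : DifferentiableOn ℂ E (ball 0 1)) (h1 : E 1 = 0)
    (hd : HasDerivAt (fun t : ℝ => E (Complex.exp (t * I))) 0 0) :
    Tendsto (fun r : ℝ => deriv E r) (nhdsWithin 1 (Iio 1)) (nhds 0) := by
  have hdc : DiffContOnCl ℂ E (ball 0 1) := ⟨hE, hK.continuous.continuousOn⟩
  rw [Metric.tendsto_nhds]
  intro ε hε
  have ho := hd.isLittleO
  simp only [Complex.ofReal_zero, zero_mul, Complex.exp_zero, h1, sub_zero, smul_zero] at ho
  have hev := ho.def (show (0 : ℝ) < ε / 60 by positivity)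
  obtain ⟨η, hη, hball⟩ := Metric.eventually_nhds_iff.1 hev
  set M : ℝ := K / η ^ 2 with hM
  have hM0 : 0 ≤ M := by positivity
  have hb : ∀ t : ℝ, |t| ≤ Real.pi →
      ‖E (Complex.exp (t * I))‖ ≤ ε / 60 * |t| + M * |t| ^ 3 := by
    intro t _
    rcases lt_or_ge |t| η with hlt | hge
    · have := hball (y := t) (by simpa using hlt)
      rw [Real.norm_eq_abs] at this
      have : 0 ≤ M * |t| ^ 3 := by positivity
      linarith
    · have h2 := hK.dist_le_mul (Complex.exp (t * I)) 1
      rw [h1, dist_zero_right, dist_eq_norm] at h2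
      have h3 : ‖Complex.exp (t * I) - 1‖ ≤ |t| := by
        have := Real.norm_exp_I_mul_ofReal_sub_one_le (x := t)
        rwa [mul_comm, Real.norm_eq_abs] at this
      have h4 : (K : ℝ) * |t| ≤ M * |t| ^ 3 := by
        rw [hM, div_mul_eq_mul_div, le_div_iff₀ (by positivity)]
        calc (K : ℝ) * |t| * η ^ 2 ≤ K * |t| * |t| ^ 2 := by gcongr
          _ = K * |t| ^ 3 := by ring
      have h5 : (K : ℝ) * ‖Complex.exp (t * I) - 1‖ ≤ K * |t| := by gcongr
      have : 0 ≤ ε / 60 * |t| := by positivity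
      linarith
  have hlim : Tendsto (fun r : ℝ => 30 * (ε / 60) + 108 * M * (1 - r)) (nhdsWithin 1 (Iio 1))
      (nhds (30 * (ε / 60) + 108 * M * (1 - 1))) :=
    Tendsto.mono_left (Continuous.tendsto (by fun_prop) 1) nhdsWithin_le_nhds
  have hlt : 30 * (ε / 60) + 108 * M * (1 - 1) < ε := by linarith
  filter_upwards [hlim.eventually_lt_const hlt, self_mem_nhdsWithin,
    mem_nhdsWithin_of_mem_nhds (Ici_mem_nhds (show (1 / 2 : ℝ) < 1 by norm_num))] with r hr hr1 hr2
  rw [dist_zero_right]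
  exact (norm_deriv_le_of_norm_exp_le hdc (by positivity) hM0 hb hr1 hr2).trans_lt hr

theorem lipschitzWith_exp_ofReal_mul_I : LipschitzWith 1 fun t : ℝ => Complex.exp (t * I) := by
  refine LipschitzWith.of_dist_le_mul fun s t => ?_
  have h : Complex.exp (s * I) - Complex.exp (t * I) =
      Complex.exp (t * I) * (Complex.exp (I * (s - t : ℝ)) - 1) := by
    rw [mul_sub, ← Complex.exp_add, mul_one]
    congr 2
    push_cast
    ring
  rw [dist_eq_norm, h, norm_mul, Complex.norm_exp_ofReal_mul_I, one_mul, NNReal.coe_one, one_mul,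
    Real.dist_eq]
  exact Real.norm_exp_I_mul_ofReal_sub_one_le

/-- **Fatou's theorem**: a bounded analytic function on the unit disc has radial limits almost
everywhere. -/
theorem ae_exists_tendsto_radial {f : ℂ → ℂ} (hf : DifferentiableOn ℂ f (ball 0 1)) {C : NNReal}
    (hC : ∀ z ∈ ball (0 : ℂ) 1, ‖f z‖ ≤ C) :
    ∀ᵐ θ : ℝ, ∃ l, Tendsto (fun r : ℝ => f (r * Complex.exp (θ * I)))
      (nhdsWithin 1 (Iio 1)) (nhds l) := by
  obtain ⟨g, hg⟩ := hf.isExactOn_ball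
  have hgL : LipschitzOnWith C g (ball 0 1) := by
    refine (convex_ball (0 : ℂ) 1).lipschitzOnWith_of_nnnorm_deriv_le
      (fun z hz => (hg z hz).differentiableAt) fun z hz => ?_
    rw [(hg z hz).deriv]
    exact hC z hz
  obtain ⟨G, hGL, hGg⟩ := hgL.extend_finite_dimension
  set K := lipschitzExtensionConstant ℂ * C
  have hG : ∀ z ∈ ball (0 : ℂ) 1, HasDerivAt G (f z) z := fun z hz =>
    (hg z hz).congr_of_eventuallyEq
      (hGg.symm.eventuallyEq_of_mem (isOpen_ball.mem_nhds hz))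
  filter_upwards [(hGL.comp lipschitzWith_exp_ofReal_mul_I).ae_differentiableAt_real] with θ hθ
  set ζ := Complex.exp (θ * I) with hζ
  have hζ1 : ‖ζ‖ = 1 := Complex.norm_exp_ofReal_mul_I θ
  have hζ0 : ζ ≠ 0 := Complex.exp_ne_zero _
  obtain ⟨β, hβ⟩ : ∃ β, HasDerivAt (fun t : ℝ => G (Complex.exp (t * I))) β θ :=
    ⟨_, hθ.hasDerivAt⟩
  set a := β / I with ha
  set E : ℂ → ℂ := fun w => G (ζ * w) - G ζ - a * (w - 1) with hEdef
  have hEd : ∀ w ∈ ball (0 : ℂ) 1, HasDerivAt E (f (ζ * w) * ζ - a) w := by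
    intro w hw
    have hmem : ζ * w ∈ ball (0 : ℂ) 1 := by simpa [hζ1] using hw
    have h1 : HasDerivAt (fun w => G (ζ * w)) (f (ζ * w) * ζ) w := by
      have h2 : HasDerivAt (fun w => ζ * w) ζ w := by
        simpa using (hasDerivAt_id w).const_mul ζ
      exact (hG _ hmem).comp w h2
    have h3 : HasDerivAt (fun w => a * (w - 1)) a w := by
      simpa using ((hasDerivAt_id w).sub_const 1).const_mul a
    exact (h1.sub_const _).sub h3
  have hEL : LipschitzWith (K + ‖a‖₊) E := by
    refine LipschitzWith.of_dist_le_mul fun x y => ?_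
    have h1 := hGL.dist_le_mul (ζ * x) (ζ * y)
    rw [dist_eq_norm, dist_eq_norm, ← mul_sub, norm_mul, hζ1, one_mul] at h1
    rw [dist_eq_norm, dist_eq_norm]
    have : E x - E y = (G (ζ * x) - G (ζ * y)) - a * (x - y) := by simp only [hEdef]; ring
    rw [this]
    refine (norm_sub_le _ _).trans ?_
    rw [norm_mul]
    push_cast
    linarith
  have hE1 : E 1 = 0 := by simp [hEdef]
  have hE0 : HasDerivAt (fun t : ℝ => E (Complex.exp (t * I))) 0 0 := by
    have h1 : HasDerivAt (fun t : ℝ => G (ζ * Complex.exp (t * I))) β 0 := by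
      have h2 : HasDerivAt (fun t : ℝ => G (Complex.exp ((θ + t : ℝ) * I))) β 0 :=
        HasDerivAt.comp_const_add θ 0 (by simpa using hβ)
      refine h2.congr_of_eventuallyEq (Filter.Eventually.of_forall fun t => ?_)
      simp only [hζ, ← Complex.exp_add]
      congr 2
      push_cast
      ring
    have h3 : HasDerivAt (fun t : ℝ => a * (Complex.exp (t * I) - 1)) (a * I) 0 := by
      have h4 : HasDerivAt (fun t : ℝ => Complex.exp (t * I)) I 0 := by
        have h5 : HasDerivAt (fun t : ℝ => (t : ℂ) * I) I 0 := by
          simpa using (Complex.ofRealCLM.hasDerivAt (x := (0 : ℝ))).mul_const I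
        simpa using h5.cexp
      exact (h4.sub_const 1).const_mul a
    have h6 := (h1.sub_const (G ζ)).sub h3
    rwa [ha, div_mul_cancel₀ _ Complex.I_ne_zero, sub_self] at h6
  have hlim := tendsto_deriv_of_hasDerivAt_zero hEL
    (fun w hw => (hEd w hw).differentiableAt.differentiableWithinAt) hE1 hE0
  refine ⟨(0 + a) / ζ, ((hlim.add_const a).div_const ζ).congr' ?_⟩
  filter_upwards [self_mem_nhdsWithin,
    mem_nhdsWithin_of_mem_nhds (Ioi_mem_nhds (zero_lt_one (α := ℝ)))] with r hr1 hr0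
  have hr : (r : ℂ) ∈ ball (0 : ℂ) 1 := by
    simpa [abs_of_pos (show 0 < r from hr0)] using hr1
  rw [(hEd _ hr).deriv, sub_add_cancel, mul_div_cancel_right₀ _ hζ0, mul_comm]

theorem measurable_exp_ofReal_mul_I : Measurable fun θ : ℝ => Complex.exp (θ * I) :=
  lipschitzWith_exp_ofReal_mul_I.continuous.measurable

instance isFiniteMeasure_circleMeasure : IsFiniteMeasure circleMeasure := by
  unfold circleMeasure
  exact Measure.smul_finite _ ENNReal.ofReal_ne_top

theorem circleMeasure_eq_zero_of_preimage {s : Set ℂ} (hs : MeasurableSet s)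
    (h : volume ((fun θ : ℝ => Complex.exp (θ * I)) ⁻¹' s ∩ Ioc (-Real.pi) Real.pi) = 0) :
    circleMeasure s = 0 := by
  rw [circleMeasure, Measure.smul_apply, Measure.map_apply measurable_exp_ofReal_mul_I hs,
    Measure.restrict_apply (measurable_exp_ofReal_mul_I hs), h, smul_zero]

theorem ae_circleMeasure_of_ae {P : ℂ → Prop} (h : ∀ᵐ θ : ℝ, P (Complex.exp (θ * I))) :
    ∀ᵐ z ∂circleMeasure, z ∈ sphere (0 : ℂ) 1 ∧ P z := by
  set S := {θ : ℝ | ¬ P (Complex.exp (θ * I))}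
  set T := toMeasurable volume S
  have hT : volume T = 0 := (measure_toMeasurable S).trans h
  have hB : circleMeasure ((sphere (0 : ℂ) 1)ᶜ ∪ Complex.arg ⁻¹' T) = 0 := by
    apply circleMeasure_eq_zero_of_preimage
    · exact isClosed_sphere.measurableSet.compl.union
        (Complex.measurable_arg (measurableSet_toMeasurable _ _))
    · refine measure_mono_null ?_ hT
      rintro θ ⟨hθ | hθ, hθ'⟩
      · exact absurd (by simp [Complex.norm_exp_ofReal_mul_I]) hθ
      · have harg : (Complex.exp (θ * I)).arg = θ := by
          rw [Complex.exp_mul_I, Complex.arg_cos_add_sin_mul_I hθ']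
        exact harg ▸ (hθ : (Complex.exp (θ * I)).arg ∈ T)
  refine measure_mono_null (fun z hz => ?_) hB
  by_contra hzB
  simp only [mem_union, not_or, mem_compl_iff, not_not, mem_preimage] at hzB
  refine hz ⟨hzB.1, ?_⟩
  by_contra hP
  refine hzB.2 (subset_toMeasurable _ _ ?_)
  have hz1 : ‖z‖ = 1 := by simpa using hzB.1
  have : Complex.exp (z.arg * I) = z := by
    have := Complex.norm_mul_exp_arg_mul_I z
    rwa [hz1, Complex.ofReal_one, one_mul] at this
  simpa [S, this] using hP

theorem ae_mem_sphere_circleMeasure : ∀ᵐ z ∂circleMeasure, z ∈ sphere (0 : ℂ) 1 :=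
  (ae_circleMeasure_of_ae (P := fun _ => True) (by simp)).mono fun _ h => h.1

theorem ofReal_mul_mem_ball {z : ℂ} (hz : z ∈ sphere (0 : ℂ) 1) {r : ℝ} (h0 : 0 < r)
    (h1 : r < 1) : (r : ℂ) * z ∈ ball (0 : ℂ) 1 := by
  have hz1 : ‖z‖ = 1 := by simpa using hz
  simpa [hz1, abs_of_pos h0] using h1

theorem eventually_ofReal_mul_mem_ball {z : ℂ} (hz : z ∈ sphere (0 : ℂ) 1) :
    ∀ᶠ r : ℝ in nhdsWithin 1 (Iio 1), (r : ℂ) * z ∈ ball (0 : ℂ) 1 := by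
  filter_upwards [self_mem_nhdsWithin,
    mem_nhdsWithin_of_mem_nhds (Ioi_mem_nhds (zero_lt_one (α := ℝ)))] with r hr1 hr0
  exact ofReal_mul_mem_ball hz hr0 hr1

theorem tendsto_ofReal_mul (z : ℂ) :
    Tendsto (fun r : ℝ => (r : ℂ) * z) (nhdsWithin 1 (Iio 1)) (nhds z) := by
  have : Tendsto (fun r : ℝ => (r : ℂ) * z) (nhds 1) (nhds ((1 : ℝ) * z)) :=
    Continuous.tendsto (by fun_prop) 1
  rw [Complex.ofReal_one, one_mul] at this
  exact this.mono_left nhdsWithin_le_nhds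

theorem H2Int_eq_integral_Ioc_neg_pi (f : ℂ → ℂ) (r : ℝ) :
    H2Int f r = (2 * Real.pi)⁻¹ *
      ∫ θ in Ioc (-Real.pi) Real.pi, ‖f ((r : ℂ) * Complex.exp (θ * I))‖ ^ 2 := by
  have hper : Function.Periodic (fun θ : ℝ => ‖f ((r : ℂ) * Complex.exp (θ * I))‖ ^ 2)
      (2 * Real.pi) := by
    intro t
    have : Complex.exp (((t + 2 * Real.pi : ℝ) : ℂ) * I) = Complex.exp (t * I) := by
      push_cast
      rw [add_mul, Complex.exp_periodic]
    simp only [this]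
  have h2 := hper.intervalIntegral_add_eq (-Real.pi) 0
  rw [show -Real.pi + 2 * Real.pi = Real.pi by ring, zero_add,
    intervalIntegral.integral_of_le (by linarith [Real.pi_pos]),
    intervalIntegral.integral_of_le (by linarith [Real.pi_pos])] at h2
  rw [H2Int, h2]

theorem bddAbove_range_H2Int {f : ℂ → ℂ} {B : ℝ} (hB : ∀ z ∈ ball (0 : ℂ) 1, ‖f z‖ ≤ B) :
    BddAbove (range fun r : Ioo (0 : ℝ) 1 => H2Int f r) := by
  refine ⟨(2 * Real.pi)⁻¹ * (B ^ 2 * volume.real (Ioc 0 (2 * Real.pi))), ?_⟩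
  rintro _ ⟨⟨r, hr0, hr1⟩, rfl⟩
  refine mul_le_mul_of_nonneg_left ((le_abs_self _).trans ?_) (by positivity)
  rw [← Real.norm_eq_abs]
  refine norm_setIntegral_le_of_norm_le_const measure_Ioc_lt_top fun θ _ => ?_
  rw [norm_pow, norm_norm]
  have := hB _ (ofReal_mul_mem_ball (z := Complex.exp (θ * I)) (by simp) hr0 hr1)
  gcongr

theorem memH2_trunc_one : MemH2 (trunc 1) := by
  have h1 : ∀ z ∈ ball (0 : ℂ) 1, trunc 1 z = 1 := fun z hz => by simp only [trunc, if_pos hz]; rfl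
  refine ⟨(differentiableOn_const (1 : ℂ)).congr h1, fun z hz => by simp only [trunc, if_neg hz],
    bddAbove_range_H2Int (B := 1) fun z hz => by simp [h1 z hz]⟩

theorem circleMeasure_eq_zero_of_isOuterF {h : ℂ → ℂ} (hout : IsOuterF h)
    (hd : DifferentiableOn ℂ h (ball 0 1)) {C : ℝ} (hC : ∀ z ∈ ball (0 : ℂ) 1, ‖h z‖ ≤ C)
    {Z : Set ℂ} (hZm : MeasurableSet Z) (hZs : Z ⊆ sphere 0 1)
    (hZ : ∀ z ∈ Z, Tendsto (fun r : ℝ => h (r * z)) (nhdsWithin 1 (Iio 1)) (nhds 0)) :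
    circleMeasure Z = 0 := by
  apply circleMeasure_eq_zero_of_preimage hZm
  set S := (fun θ : ℝ => Complex.exp (θ * I)) ⁻¹' Z ∩ Ioc (-Real.pi) Real.pi with hS
  have hSm : MeasurableSet S := (measurable_exp_ofReal_mul_I hZm).inter measurableSet_Ioc
  have hSfin : volume S ≠ ⊤ := ((measure_mono inter_subset_right).trans_lt (by simp)).ne
  rw [← measureReal_eq_zero_iff hSfin]
  refine le_antisymm (le_of_forall_pos_le_add fun δ hδ => ?_) measureReal_nonneg
  rw [zero_add]
  have hpi := Real.pi_pos
  obtain ⟨p, hp⟩ := hout.2 _ memH2_trunc_one (Real.sqrt (δ / (2 * Real.pi)))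
    (Real.sqrt_pos.2 (by positivity))
  set q : ℂ → ℂ := fun z => trunc 1 z - p.eval z * trunc h z with hq
  have hqb : ∀ z ∈ ball (0 : ℂ) 1, q z = 1 - p.eval z * h z := fun z hz => by
    simp only [hq, trunc, if_pos hz, Pi.one_apply]
  have hqd : ContinuousOn q (ball 0 1) :=
    ((continuousOn_const (c := (1 : ℂ))).sub
      (p.continuous.continuousOn.mul hd.continuousOn)).congr hqb
  obtain ⟨P, hP⟩ := (isCompact_closedBall (0 : ℂ) 1).exists_bound_of_continuousOn
    p.continuous.continuousOn
  have hP0 : 0 ≤ P := (norm_nonneg _).trans (hP 0 (by simp))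
  have hqB : ∀ z ∈ ball (0 : ℂ) 1, ‖q z‖ ≤ 1 + P * C := fun z hz => by
    rw [hqb z hz]
    refine (norm_sub_le _ _).trans ?_
    rw [norm_one, norm_mul]
    have h1 := hP z (ball_subset_closedBall hz)
    have h2 := hC z hz
    gcongr
  have hsup := (Real.sqrt_lt_sqrt_iff_of_pos (by positivity)).1 hp
  have hle : ∀ r : ℝ, 0 < r → r < 1 →
      ∫ θ in S, ‖q ((r : ℂ) * Complex.exp (θ * I))‖ ^ 2 ≤ δ := by
    intro r hr0 hr1
    have h1 : H2Int q r ≤ δ / (2 * Real.pi) :=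
      (le_ciSup (bddAbove_range_H2Int hqB) ⟨r, hr0, hr1⟩).trans hsup.le
    rw [H2Int_eq_integral_Ioc_neg_pi, div_eq_inv_mul, mul_le_mul_iff_right₀ (by positivity)] at h1
    refine le_trans (setIntegral_mono_set ?_ ?_ ?_) h1
    · have hc : Continuous fun θ : ℝ => ‖q ((r : ℂ) * Complex.exp (θ * I))‖ ^ 2 := by
        refine (Continuous.norm ?_).pow 2
        exact hqd.comp_continuous (by fun_prop) fun θ => ofReal_mul_mem_ball (by simp) hr0 hr1
      exact (hc.integrableOn_Icc).mono_set Ioc_subset_Icc_self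
    · exact Filter.Eventually.of_forall fun θ => by positivity
    · exact LE.le.eventuallyLE inter_subset_right
  have hlim : Tendsto (fun r : ℝ => ∫ θ in S, ‖q ((r : ℂ) * Complex.exp (θ * I))‖ ^ 2)
      (nhdsWithin 1 (Iio 1)) (nhds (∫ _ in S, (1 : ℝ))) := by
    refine tendsto_integral_filter_of_dominated_convergence (fun _ => (1 + P * C) ^ 2) ?_ ?_ ?_ ?_
    · filter_upwards [mem_nhdsWithin_of_mem_nhds (Ioi_mem_nhds (zero_lt_one (α := ℝ))),
        self_mem_nhdsWithin] with r hr0 hr1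
      have hc : Continuous fun θ : ℝ => ‖q ((r : ℂ) * Complex.exp (θ * I))‖ ^ 2 := by
        refine (Continuous.norm ?_).pow 2
        exact hqd.comp_continuous (by fun_prop) fun θ => ofReal_mul_mem_ball (by simp) hr0 hr1
      exact hc.aestronglyMeasurable
    · filter_upwards [mem_nhdsWithin_of_mem_nhds (Ioi_mem_nhds (zero_lt_one (α := ℝ))),
        self_mem_nhdsWithin] with r hr0 hr1
      refine Filter.Eventually.of_forall fun θ => ?_
      rw [norm_pow, norm_norm]
      have := hqB _ (ofReal_mul_mem_ball (z := Complex.exp (θ * I)) (by simp) hr0 hr1)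
      gcongr
    · exact integrableOn_const hSfin
    · refine (ae_restrict_iff' hSm).2 (Filter.Eventually.of_forall fun θ hθ => ?_)
      have hz := hZ _ hθ.1
      have h1 : Tendsto (fun r : ℝ => 1 - p.eval ((r : ℂ) * Complex.exp (θ * I)) *
          h (r * Complex.exp (θ * I))) (nhdsWithin 1 (Iio 1)) (nhds 1) := by
        have := ((p.continuous.tendsto _).comp (tendsto_ofReal_mul (Complex.exp (θ * I)))).mul hz
        simpa using this.const_sub 1
      have h2 := (h1.norm.pow 2)
      rw [norm_one, one_pow] at h2
      refine h2.congr' ?_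
      filter_upwards [eventually_ofReal_mul_mem_ball (hZs hθ.1)] with r hr
      rw [hqb _ hr]
  have hfinal : ∫ _ in S, (1 : ℝ) ≤ δ := by
    refine le_of_tendsto hlim ?_
    filter_upwards [mem_nhdsWithin_of_mem_nhds (Ioi_mem_nhds (zero_lt_one (α := ℝ))),
      self_mem_nhdsWithin] with r hr0 hr1
    exact hle r hr0 hr1
  simpa using hfinal

theorem radLimF_eq_of_not_exists {f : ℂ → ℂ} {z : ℂ}
    (h : ¬ ∃ l, Tendsto (fun r : ℝ => f ((r : ℂ) * z)) (nhdsWithin 1 (Iio 1)) (nhds l)) :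
    radLimF f z = Classical.epsilon fun _ : ℂ => False := by
  push Not at h
  unfold radLimF limUnder lim
  congr 1
  ext l
  exact iff_of_false (h l) not_false

theorem isClosed_ZTF (f : ℂ → ℂ) : IsClosed (ZTF f) := by
  rw [← isOpen_compl_iff, isOpen_iff_forall_mem_open]
  intro z hz
  by_cases hzs : z ∈ sphere (0 : ℂ) 1
  · have : ¬ ∀ ε > (0 : ℝ), ∀ N : Set ℂ, IsOpen N → z ∈ N →
        circleMeasure ({w : ℂ | ‖radLimF f w‖ ∈ Ioo 0 ε} ∩ N) ≠ 0 := fun h => hz ⟨hzs, h⟩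
    push Not at this
    obtain ⟨ε, hε, N, hN, hzN, h0⟩ := this
    exact ⟨N, fun w hw hwZ => hwZ.2 ε hε N hN hw h0, hN, hzN⟩
  · exact ⟨(sphere 0 1)ᶜ, fun w hw hwZ => hw hwZ.1, isClosed_sphere.isOpen_compl, hzs⟩

theorem isCompact_ZTF (f : ℂ → ℂ) : IsCompact (ZTF f) :=
  (isCompact_sphere (0 : ℂ) 1).of_isClosed_subset (isClosed_ZTF f) fun _ hz => hz.1

theorem exists_mem_ball_norm_lt_of_mem_ZTF {f : ℂ → ℂ} {z : ℂ} (hz : z ∈ ZTF f) {ε : ℝ}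
    (hε : 0 < ε) {N : Set ℂ} (hN : IsOpen N) (hzN : z ∈ N) :
    ∃ w ∈ N ∩ ball (0 : ℂ) 1, ‖f w‖ < ε := by
  set c : ℂ := Classical.epsilon fun _ : ℂ => False with hc
  obtain ⟨ε', hε', hle, hcε⟩ : ∃ ε' > 0, ε' ≤ ε ∧ ‖c‖ ∉ Ioo 0 ε' := by
    rcases (norm_nonneg c).eq_or_lt with h0 | h0
    · exact ⟨ε, hε, le_rfl, fun h => h.1.ne h0⟩
    · exact ⟨min ε ‖c‖, lt_min hε h0, min_le_left _ _, fun h => absurd h.2 (by simp)⟩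
  have hne := hz.2 ε' hε' N hN hzN
  obtain ⟨w, ⟨hw, hwN⟩, hws⟩ :
      (({w : ℂ | ‖radLimF f w‖ ∈ Ioo 0 ε'} ∩ N) ∩ sphere (0 : ℂ) 1).Nonempty := by
    rw [nonempty_iff_ne_empty]
    intro hemp
    refine hne (measure_mono_null (fun w hw => ?_) ae_mem_sphere_circleMeasure)
    intro hws
    exact (hemp ▸ ⟨hw, hws⟩ : w ∈ (∅ : Set ℂ))
  have hex : ∃ l, Tendsto (fun r : ℝ => f ((r : ℂ) * w)) (nhdsWithin 1 (Iio 1)) (nhds l) := by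
    by_contra h
    rw [mem_ofPred_eq, radLimF_eq_of_not_exists h] at hw
    exact hcε hw
  have hlim : Tendsto (fun r : ℝ => f ((r : ℂ) * w)) (nhdsWithin 1 (Iio 1))
    (nhds (radLimF f w)) := tendsto_nhds_limUnder hex
  obtain ⟨r, h1, h2, h3⟩ := ((hlim.norm.eventually_lt_const hw.2).and
    (((tendsto_ofReal_mul w).eventually (hN.mem_nhds hwN)).and
      (eventually_ofReal_mul_mem_ball hws))).exists
  exact ⟨_, ⟨h2, h3⟩, h1.trans_le hle⟩

theorem eq_zero_of_mem_ZTF {f F : ℂ → ℂ} (hF : ContinuousOn F (ball 0 1 ∪ ZTF f))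
    (hFf : ∀ z ∈ ball (0 : ℂ) 1, F z = f z) {z : ℂ} (hz : z ∈ ZTF f) : F z = 0 := by
  rw [← norm_eq_zero]
  refine le_antisymm (le_of_forall_pos_le_add fun ε hε => ?_) (norm_nonneg _)
  by_contra! hlt
  rw [zero_add] at hlt
  have hc := (hF z (Or.inr hz)).norm.eventually_const_lt hlt
  obtain ⟨N, hN, hzN, hsub⟩ := mem_nhdsWithin.1 hc
  obtain ⟨w, ⟨hwN, hwb⟩, hw⟩ := exists_mem_ball_norm_lt_of_mem_ZTF hz hε hN hzN
  have h1 : ε < ‖F w‖ := hsub ⟨hwN, Or.inl hwb⟩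
  rw [hFf w hwb] at h1
  exact lt_asymm h1 hw

theorem exists_thickening_norm_le {f F : ℂ → ℂ} (hF : ContinuousOn F (ball 0 1 ∪ ZTF f))
    (hFf : ∀ z ∈ ball (0 : ℂ) 1, F z = f z) {ε : ℝ} (hε : 0 < ε) :
    ∃ δ > 0, ∀ w ∈ thickening δ (ZTF f) ∩ ball 0 1, ‖f w‖ ≤ ε := by
  have hloc : ∀ z ∈ ZTF f, ∃ N : Set ℂ, IsOpen N ∧ z ∈ N ∧ ∀ w ∈ N ∩ ball 0 1, ‖f w‖ ≤ ε := by
    intro z hz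
    have hlt : ‖F z‖ < ε := by rwa [eq_zero_of_mem_ZTF hF hFf hz, norm_zero]
    obtain ⟨N, hN, hzN, hsub⟩ :=
      mem_nhdsWithin.1 ((hF z (Or.inr hz)).norm.eventually_lt_const hlt)
    refine ⟨N, hN, hzN, fun w hw => ?_⟩
    rw [← hFf w hw.2]
    exact (show ‖F w‖ < ε from hsub ⟨hw.1, Or.inl hw.2⟩).le
  choose! N hN hzN hsub using hloc
  obtain ⟨δ, hδ, hδs⟩ := (isCompact_ZTF f).exists_thickening_subset_open
    (isOpen_biUnion fun z hz => hN z hz) fun z hz => mem_biUnion hz (hzN z hz)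
  refine ⟨δ, hδ, fun w hw => ?_⟩
  obtain ⟨z, hz, hwz⟩ := mem_iUnion₂.1 (hδs hw.1)
  exact hsub z hz w ⟨hwz, hw.2⟩

theorem exists_strictAnti_le_tendsto_zero {δ : ℕ → ℝ} (hδ : ∀ n, 0 < δ n) :
    ∃ η : ℕ → ℝ, (∀ n, 0 < η n) ∧ (∀ n, η (n + 1) < η n) ∧ (∀ n, η n ≤ δ n) ∧
      Tendsto η atTop (nhds 0) := by
  set η : ℕ → ℝ := fun n => Nat.rec (δ 0) (fun n x => min (δ (n + 1)) (x / 2)) n with hη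
  have hs : ∀ n, η (n + 1) = min (δ (n + 1)) (η n / 2) := fun n => rfl
  have hpos : ∀ n, 0 < η n := by
    intro n
    induction n with
    | zero => exact hδ 0
    | succ n ih => rw [hs]; exact lt_min (hδ _) (half_pos ih)
  have hle : ∀ n, η n ≤ δ 0 * (1 / 2) ^ n := by
    intro n
    induction n with
    | zero => simp [hη]
    | succ n ih =>
      have := min_le_right (δ (n + 1)) (η n / 2)
      rw [hs, pow_succ]
      linarith
  refine ⟨η, hpos, fun n => ?_, fun n => ?_, ?_⟩
  · have := min_le_right (δ (n + 1)) (η n / 2)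
    rw [hs]
    linarith [hpos n]
  · cases n with
    | zero => exact le_rfl
    | succ n => exact min_le_left _ _
  · refine squeeze_zero (fun n => (hpos n).le) hle ?_
    simpa using (tendsto_pow_atTop_nhds_zero_of_lt_one (r := (1 / 2 : ℝ)) (by norm_num)
      (by norm_num)).const_mul (δ 0)

theorem differentiableOn_hfun (f : Hinf) : DifferentiableOn ℂ (hfun f) (ball 0 1) := f.2

theorem norm_hfun_le (f : Hinf) {z : ℂ} (hz : z ∈ ball (0 : ℂ) 1) :
    ‖hfun f z‖ ≤ ‖(f : BoundedContinuousFunction (ball (0 : ℂ) 1 : Set ℂ) ℂ)‖ := by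
  rw [hfun, cext_of_mem _ hz]
  exact BoundedContinuousFunction.norm_coe_le_norm _ _

/-- For an outer function `f ∈ Z^∞(𝔻)` there is a sequence of relatively open subsets `A m` of
the circle with `Z_𝕋(f) ⊆ A m`, `closure (A (m+1)) ⊆ U_m ⊆ A m` for some open `U_m`,
`μ(A m) ↘ 0`, and `|f̃| ≤ e^{-m}` a.e. on `A m`. -/
theorem exists_shrinking_neighborhoods_of_outer (f : Hinf) (hfZ : f ∈ Zinf)
    (hout : IsOuterHinf f) :
    ∃ A : ℕ → Set ℂ,
      (∀ m, 1 ≤ m → IsOpenInCircle (A m)) ∧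
      (∀ m, 1 ≤ m → ZT f ⊆ A m) ∧
      (∀ m, 1 ≤ m → ∃ U : Set ℂ, IsOpenInCircle U ∧ closure (A (m+1)) ⊆ U ∧ U ⊆ A m) ∧
      (∀ m, 1 ≤ m → circleMeasure (A (m+1)) ≤ circleMeasure (A m)) ∧
      Filter.Tendsto (fun m => circleMeasure (A m)) Filter.atTop (nhds 0) ∧
      (∀ m, 1 ≤ m →
        ∀ᵐ z ∂circleMeasure, z ∈ A m → ‖radLimF (hfun f) z‖ ≤ Real.exp (-(m:ℝ))) := by
  obtain ⟨F, hF, hFf⟩ := hfZ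
  have hZlim : ∀ z ∈ ZT f, Tendsto (fun r : ℝ => hfun f (r * z)) (nhdsWithin 1 (Iio 1))
      (nhds 0) := by
    intro z hz
    have h1 := hF z (Or.inr hz)
    rw [ContinuousWithinAt, eq_zero_of_mem_ZTF hF hFf hz] at h1
    have hmem := eventually_ofReal_mul_mem_ball hz.1
    refine (h1.comp (tendsto_nhdsWithin_iff.2
      ⟨tendsto_ofReal_mul z, hmem.mono fun r hr => Or.inl hr⟩)).congr' ?_
    filter_upwards [hmem] with r hr using hFf _ hr
  have hZ0 : circleMeasure (ZT f) = 0 :=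
    circleMeasure_eq_zero_of_isOuterF hout (differentiableOn_hfun f) (fun z hz => norm_hfun_le f hz)
      (isClosed_ZTF _).measurableSet (fun z hz => hz.1) hZlim
  choose δ hδ hδf using fun m : ℕ =>
    exists_thickening_norm_le hF hFf (Real.exp_pos (-(m : ℝ)))
  obtain ⟨η, hη, hηlt, hηδ, hηlim⟩ := exists_strictAnti_le_tendsto_zero hδ
  have hcl : ∀ m, closure (thickening (η (m + 1)) (ZT f) ∩ sphere 0 1) ⊆
      thickening (η m) (ZT f) ∩ sphere 0 1 := by
    intro m z hz
    have hz' := closure_inter_subset_inter_closure _ _ hz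
    rw [isClosed_sphere.closure_eq] at hz'
    exact ⟨cthickening_subset_thickening' (hη m) (hηlt m) _
      (closure_thickening_subset_cthickening _ _ hz'.1), hz'.2⟩
  have hopen : ∀ m, IsOpenInCircle (thickening (η m) (ZT f) ∩ sphere 0 1) := fun m =>
    ⟨_, isOpen_thickening, rfl⟩
  refine ⟨fun m => thickening (η m) (ZT f) ∩ sphere 0 1, fun m _ => hopen m,
    fun m _ z hz => ⟨self_subset_thickening (hη m) _ hz, hz.1⟩,
    fun m _ => ⟨_, hopen m, hcl m, subset_rfl⟩,
    fun m _ => measure_mono (subset_closure.trans (hcl m)), ?_, fun m _ => ?_⟩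
  · have h1 := (tendsto_measure_cthickening_of_isCompact (μ := circleMeasure)
      (isCompact_ZTF (hfun f))).comp hηlim
    rw [show circleMeasure (ZTF (hfun f)) = 0 from hZ0] at h1
    exact tendsto_of_tendsto_of_tendsto_of_le_of_le tendsto_const_nhds h1 (fun _ => zero_le)
      fun m => measure_mono (inter_subset_left.trans (thickening_subset_cthickening _ _))
  · filter_upwards [ae_circleMeasure_of_ae (P := fun z => ∃ l, Tendsto
      (fun r : ℝ => hfun f (r * z)) (nhdsWithin 1 (Iio 1)) (nhds l))
      (ae_exists_tendsto_radial (differentiableOn_hfun f)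
      (C := ‖(f : BoundedContinuousFunction (ball (0 : ℂ) 1 : Set ℂ) ℂ)‖₊)
      fun z hz => norm_hfun_le f hz)] with z hz hzA
    have hlim : Tendsto (fun r : ℝ => hfun f ((r : ℂ) * z)) (nhdsWithin 1 (Iio 1))
      (nhds (radLimF (hfun f) z)) := tendsto_nhds_limUnder hz.2
    refine le_of_tendsto hlim.norm ?_
    filter_upwards [eventually_ofReal_mul_mem_ball hz.1,
      (tendsto_ofReal_mul z).eventually (isOpen_thickening.mem_nhds hzA.1)] with r hr1 hr2
    exact hδf m _ ⟨thickening_mono (hηδ m) _ hr2, hr1⟩
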